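/- arXiv:1703.02462 — 3 statements merged into one kernel-verified Lean document; each statement's English description precedes it below -/
import Mathlib

section
/- Let I be a nonempty finite index set, let ν_i > 0, a_i ∈ ℝ, r_i ∈ ℝ for i ∈ I, let λ ≥ 0 and 0 ≤ γ ≤ 1, and assume Σ_{i∈I} ν_i a_i² + λ(1 − γ) > 0. Then the elastic-net coordinate objective f(β) = (1/2) Σ_{i∈I} ν_i (r_i − a_i β)² + λγ|β| + (1/2) λ(1 − γ) β² on ℝ attains a unique global minimum at β* = S(Σ_{i∈I} ν_i a_i r_i, λγ) / (Σ_{i∈I} ν_i a_i² + λ(1 − γ)). -/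
open scoped BigOperators

/-- The soft-thresholding operator `S(z, λ) = sign(z)(|z| − λ)₊`. -/
noncomputable def softThresh (z lam : ℝ) : ℝ :=
  Real.sign z * max (|z| - lam) 0

/-- The residual of soft thresholding is bounded by the threshold. -/
lemma abs_sub_softThresh_le {z t : ℝ} (ht : 0 ≤ t) : |z - softThresh z t| ≤ t := by
  unfold softThresh
  rcases lt_trichotomy z 0 with h | rfl | h
  · rw [Real.sign_of_neg h, abs_of_neg h, abs_le]
    rcases max_cases (-z - t) 0 with h' | h' <;> constructor <;> linarith
  · simpa using ht
  · rw [Real.sign_of_pos h, abs_of_pos h, abs_le]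
    rcases max_cases (z - t) 0 with h' | h' <;> constructor <;> linarith

/-- Where soft thresholding does not vanish, its residual is the threshold with matching sign. -/
lemma sub_softThresh_mul_softThresh (z t : ℝ) :
    (z - softThresh z t) * softThresh z t = t * |softThresh z t| := by
  unfold softThresh
  rcases lt_trichotomy z 0 with h | rfl | h
  · rw [Real.sign_of_neg h, abs_of_neg h, abs_mul, abs_of_nonneg (le_max_right (_ - t) _)]
    rcases max_cases (-z - t) 0 with h' | h' <;> rw [h'.1] <;> norm_num
    ring
  · simp
  · rw [Real.sign_of_pos h, abs_of_pos h, abs_mul, abs_of_nonneg (le_max_right (_ - t) _)]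
    rcases max_cases (z - t) 0 with h' | h' <;> rw [h'.1] <;> norm_num

/-- The scalar problem `D / 2 * x ^ 2 - z * x + t * |x|` with `D > 0` has the unique minimizer
`softThresh z t / D`. -/
lemma softThresh_div_strict_min {z t D x : ℝ} (ht : 0 ≤ t) (hD : 0 < D)
    (hx : x ≠ softThresh z t / D) :
    D / 2 * (softThresh z t / D) ^ 2 - z * (softThresh z t / D) + t * |softThresh z t / D|
      < D / 2 * x ^ 2 - z * x + t * |x| := by
  have hres := abs_sub_softThresh_le (z := z) ht
  have hmul := sub_softThresh_mul_softThresh z t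
  set S := softThresh z t
  obtain ⟨b, hb⟩ : ∃ b, b = S / D := ⟨_, rfl⟩
  have hS : S = D * b := by rw [hb]; field_simp
  rw [← hb] at hx ⊢
  have hsub : (z - S) * b = t * |b| := by
    refine mul_left_cancel₀ hD.ne' ?_
    have habs : |S| = D * |b| := by rw [hS, abs_mul, abs_of_pos hD]
    calc D * ((z - S) * b) = (z - S) * (D * b) := by ring
      _ = t * |S| := by rw [← hS, hmul]
      _ = D * (t * |b|) := by rw [habs]; ring
  have hle : (z - S) * x ≤ t * |x| :=
    calc (z - S) * x ≤ |z - S| * |x| := by rw [← abs_mul]; exact le_abs_self _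
      _ ≤ t * |x| := by gcongr
  have hsq : 0 < D / 2 * (x - b) ^ 2 := by
    have := sub_ne_zero.mpr hx
    positivity
  rw [hS] at hsub hle
  linarith

/-- Let `I` be a nonempty finite index set, `ν_i > 0`, `a_i, r_i ∈ ℝ`,
`λ ≥ 0`, `0 ≤ γ ≤ 1` with `Σ ν_i a_i² + λ(1 − γ) > 0`.  Then the elastic-net coordinate
objective `f(β) = (1/2) Σ ν_i (r_i − a_i β)² + λγ|β| + (1/2)λ(1 − γ)β²` attains a unique
global minimum at `β* = S(Σ ν_i a_i r_i, λγ) / (Σ ν_i a_i² + λ(1 − γ))`. -/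
theorem elastic_net_coordinate_update {ι : Type*} (s : Finset ι) (hs : s.Nonempty)
    (ν a r : ι → ℝ) (hν : ∀ i ∈ s, 0 < ν i)
    (lam γ : ℝ) (hlam : 0 ≤ lam) (hγ0 : 0 ≤ γ) (hγ1 : γ ≤ 1)
    (hden : 0 < ∑ i ∈ s, ν i * a i ^ 2 + lam * (1 - γ)) :
    ∀ β : ℝ,
      β ≠ softThresh (∑ i ∈ s, ν i * a i * r i) (lam * γ)
            / (∑ i ∈ s, ν i * a i ^ 2 + lam * (1 - γ)) →
      (fun b : ℝ => (1 / 2) * ∑ i ∈ s, ν i * (r i - a i * b) ^ 2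
          + lam * γ * |b| + (1 / 2) * lam * (1 - γ) * b ^ 2)
          (softThresh (∑ i ∈ s, ν i * a i * r i) (lam * γ)
            / (∑ i ∈ s, ν i * a i ^ 2 + lam * (1 - γ)))
        < (1 / 2) * ∑ i ∈ s, ν i * (r i - a i * β) ^ 2
          + lam * γ * |β| + (1 / 2) * lam * (1 - γ) * β ^ 2 := by
  intro β hβ
  have hexp : ∀ b : ℝ, ∑ i ∈ s, ν i * (r i - a i * b) ^ 2
      = ∑ i ∈ s, ν i * r i ^ 2 - 2 * b * ∑ i ∈ s, ν i * a i * r i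
        + b ^ 2 * ∑ i ∈ s, ν i * a i ^ 2 := fun b => by
    rw [Finset.mul_sum, Finset.mul_sum, ← Finset.sum_sub_distrib, ← Finset.sum_add_distrib]
    exact Finset.sum_congr rfl fun i _ => by ring
  have hmin := softThresh_div_strict_min (mul_nonneg hlam hγ0) hden hβ
  simp only [hexp]
  linarith
end

section
/- Let η̃ > 0, g̃ ∈ ℝ, λ ≥ 0 and γ > 1 + 1/η̃. Then the function f(β) = (1/2) η̃ β² − g̃ β + p_λ(|β|), where p_λ is the SCAD penalty with parameters λ and γ, attains a global minimum on ℝ at β* given by: β* = S(g̃, λ)/η̃ if |g̃| ≤ λ(η̃ + 1); β* = S(g̃, γλ/(γ − 1)) / (η̃ − 1/(γ − 1)) if λ(η̃ + 1) ≤ |g̃| ≤ η̃λγ; and β* = g̃/η̃ if |g̃| ≥ η̃λγ. -/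
/-- The SCAD penalty with parameters `λ` and `γ`: `p_λ(θ) = λθ` for `θ ≤ λ`,
`p_λ(θ) = (γλθ − (θ² + λ²)/2)/(γ − 1)` for `λ ≤ θ ≤ γλ`, and
`p_λ(θ) = λ²(γ² − 1)/(2(γ − 1))` for `θ ≥ γλ`. -/
noncomputable def scad (lam γ θ : ℝ) : ℝ :=
  if θ ≤ lam then lam * θ
  else if θ ≤ γ * lam then (γ * lam * θ - (θ ^ 2 + lam ^ 2) / 2) / (γ - 1)
  else lam ^ 2 * (γ ^ 2 - 1) / (2 * (γ - 1))

theorem scad_eq_posPart {lam γ : ℝ} (hlam : 0 ≤ lam) (hγ : 1 < γ) (θ : ℝ) :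
    scad lam γ θ = 1 / (γ - 1) * (γ * lam * θ - (θ ^ 2 + lam ^ 2) / 2
      + max (lam - θ) 0 ^ 2 / 2 + max (θ - γ * lam) 0 ^ 2 / 2) := by
  have hk : γ - 1 ≠ 0 := by linarith
  have hle : lam ≤ γ * lam := by nlinarith
  unfold scad
  split_ifs with h₁ h₂
  · rw [max_eq_left (by linarith), max_eq_right (by linarith)]
    field_simp
    ring
  · rw [max_eq_right (by linarith), max_eq_right (by linarith)]
    field_simp
    ring
  · rw [max_eq_right (by linarith), max_eq_left (by linarith)]
    field_simp
    ring

theorem max_zero_sq_tangent_le (x y : ℝ) :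
    max x 0 ^ 2 + 2 * max x 0 * (y - x) ≤ max y 0 ^ 2 := by
  rcases le_total x 0 with hx | hx
  · rw [max_eq_right hx]
    nlinarith [sq_nonneg (max y 0)]
  · rw [max_eq_left hx]
    nlinarith [sq_nonneg (max y 0 - x), le_max_left y 0]

/-- The derivative of the SCAD penalty on `[0, ∞)`. -/
noncomputable def scadDeriv (lam γ t : ℝ) : ℝ :=
  1 / (γ - 1) * (γ * lam - t - max (lam - t) 0 + max (t - γ * lam) 0)

theorem scadDeriv_of_le {lam γ t : ℝ} (hlam : 0 ≤ lam) (hγ : 1 < γ) (ht : t ≤ lam) :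
    scadDeriv lam γ t = lam := by
  have hk : γ - 1 ≠ 0 := by linarith
  have hle : lam ≤ γ * lam := by nlinarith
  rw [scadDeriv, max_eq_left (by linarith), max_eq_right (by linarith)]
  field_simp
  ring

theorem scadDeriv_of_mem_Icc {lam γ t : ℝ} (h₁ : lam ≤ t) (h₂ : t ≤ γ * lam) :
    scadDeriv lam γ t = 1 / (γ - 1) * (γ * lam - t) := by
  rw [scadDeriv, max_eq_right (by linarith), max_eq_right (by linarith)]
  ring

theorem scadDeriv_of_ge {lam γ t : ℝ} (hlam : 0 ≤ lam) (hγ : 1 < γ) (ht : γ * lam ≤ t) :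
    scadDeriv lam γ t = 0 := by
  have hle : lam ≤ γ * lam := by nlinarith
  rw [scadDeriv, max_eq_right (by linarith), max_eq_left (by linarith)]
  ring

/-- The SCAD penalty is weakly convex with modulus `1 / (γ - 1)`. -/
theorem scad_tangent_le {lam γ : ℝ} (hlam : 0 ≤ lam) (hγ : 1 < γ) (t θ : ℝ) :
    scad lam γ t + scadDeriv lam γ t * (θ - t) - 1 / (γ - 1) * (θ - t) ^ 2 / 2
      ≤ scad lam γ θ := by
  have hc : 0 < 1 / (γ - 1) := one_div_pos.mpr (by linarith)
  rw [scad_eq_posPart hlam hγ, scad_eq_posPart hlam hγ, scadDeriv]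
  have h₁ := mul_le_mul_of_nonneg_left (max_zero_sq_tangent_le (lam - t) (lam - θ)) hc.le
  have h₂ := mul_le_mul_of_nonneg_left
    (max_zero_sq_tangent_le (t - γ * lam) (θ - γ * lam)) hc.le
  linarith

/-- A point `b` with the sign of `g` minimizes the SCAD-penalized quadratic as soon as `|b|`
satisfies the first-order condition on `[0, ∞)`. -/
theorem scad_quadratic_le_of_first_order {η g lam γ b : ℝ} (hlam : 0 ≤ lam) (hγ : 1 < γ)
    (hc : 1 / (γ - 1) ≤ η) (hb : g * b = |g| * |b|)
    (hfirst : ∀ θ, 0 ≤ θ → 0 ≤ (η * |b| + scadDeriv lam γ |b| - |g|) * (θ - |b|)) (β : ℝ) :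
    (1 / 2) * η * b ^ 2 - g * b + scad lam γ |b|
      ≤ (1 / 2) * η * β ^ 2 - g * β + scad lam γ |β| := by
  have hβ : g * β ≤ |g| * |β| := abs_mul g β ▸ le_abs_self _
  have htangent := scad_tangent_le hlam hγ |b| |β|
  have hopt := hfirst |β| (abs_nonneg β)
  have hquad := mul_nonneg (sub_nonneg.mpr hc) (sq_nonneg (|β| - |b|))
  rw [hb, ← sq_abs b, ← sq_abs β]
  linarith

theorem abs_softThresh {x : ℝ} (hx : 0 ≤ x) (z : ℝ) : |softThresh z x| = max (|z| - x) 0 := by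
  rcases eq_or_ne z 0 with rfl | hz
  · simp [softThresh, hx]
  · have hsign : |Real.sign z| = 1 := by
      rcases Real.sign_apply_eq_of_ne_zero z hz with h | h <;> simp [h]
    rw [softThresh, abs_mul, hsign, one_mul, abs_of_nonneg (le_max_right _ _)]

theorem mul_softThresh {x : ℝ} (hx : 0 ≤ x) (z : ℝ) :
    z * softThresh z x = |z| * |softThresh z x| := by
  rw [abs_softThresh hx, softThresh, ← mul_assoc]
  congr 1
  rcases lt_trichotomy z 0 with h | rfl | h
  · simp [Real.sign_of_neg h, abs_of_neg h]
  · simp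
  · simp [Real.sign_of_pos h, abs_of_pos h]

/-- Let `η̃ > 0`, `g̃ ∈ ℝ`, `λ ≥ 0` and `γ > 1 + 1/η̃`.  Then
`f(β) = (1/2) η̃ β² − g̃ β + p_λ(|β|)` (SCAD penalty) attains a global minimum on `ℝ` at
`β* = S(g̃, λ)/η̃` if `|g̃| ≤ λ(η̃ + 1)`;
`β* = S(g̃, γλ/(γ − 1)) / (η̃ − 1/(γ − 1))` if `λ(η̃ + 1) ≤ |g̃| ≤ η̃λγ`; and
`β* = g̃/η̃` if `|g̃| ≥ η̃λγ`. -/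
theorem scad_coordinate_update (η g lam γ : ℝ) (hη : 0 < η) (hlam : 0 ≤ lam)
    (hγ : γ > 1 + 1 / η) :
    ((|g| ≤ lam * (η + 1) →
        ∀ β : ℝ, (1 / 2) * η * (softThresh g lam / η) ^ 2 - g * (softThresh g lam / η)
            + scad lam γ |softThresh g lam / η|
          ≤ (1 / 2) * η * β ^ 2 - g * β + scad lam γ |β|)) ∧
    ((lam * (η + 1) ≤ |g| → |g| ≤ η * lam * γ →
        ∀ β : ℝ,
          (1 / 2) * η * (softThresh g (γ * lam / (γ - 1)) / (η - 1 / (γ - 1))) ^ 2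
              - g * (softThresh g (γ * lam / (γ - 1)) / (η - 1 / (γ - 1)))
              + scad lam γ |softThresh g (γ * lam / (γ - 1)) / (η - 1 / (γ - 1))|
          ≤ (1 / 2) * η * β ^ 2 - g * β + scad lam γ |β|)) ∧
    ((η * lam * γ ≤ |g| →
        ∀ β : ℝ, (1 / 2) * η * (g / η) ^ 2 - g * (g / η) + scad lam γ |g / η|
          ≤ (1 / 2) * η * β ^ 2 - g * β + scad lam γ |β|)) := by
  have hγ₁ : 1 < γ := by linarith [one_div_pos.mpr hη]
  have hk : 0 < γ - 1 := by linarith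
  have hc : 1 / (γ - 1) < η := (one_div_lt hk hη).mpr (by linarith)
  refine ⟨fun hg => ?_, fun hg₁ hg₂ => ?_, fun hg => ?_⟩
  · have habs : |softThresh g lam / η| = max (|g| - lam) 0 / η := by
      rw [abs_div, abs_softThresh hlam, abs_of_pos hη]
    refine scad_quadratic_le_of_first_order hlam hγ₁ hc.le ?_ fun θ hθ => ?_
    · rw [abs_div, abs_of_pos hη, ← mul_div_assoc, mul_softThresh hlam, mul_div_assoc]
    · have hle : max (|g| - lam) 0 / η ≤ lam :=
        (div_le_iff₀ hη).mpr (max_le (by linarith) (by positivity))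
      rw [habs, scadDeriv_of_le hlam hγ₁ hle, mul_div_cancel₀ _ hη.ne']
      rcases le_total |g| lam with h | h
      · rw [max_eq_right (by linarith)]
        simpa using mul_nonneg (sub_nonneg.mpr h) hθ
      · rw [max_eq_left (by linarith)]
        simp
  · have hd : 0 < η - 1 / (γ - 1) := sub_pos.mpr hc
    have hx : 0 ≤ γ * lam / (γ - 1) := by positivity
    have hxc : γ * lam / (γ - 1) = lam + 1 / (γ - 1) * lam := by
      field_simp
      ring
    have hxγ : γ * lam / (γ - 1) = 1 / (γ - 1) * (γ * lam) := by ring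
    have hclam := mul_nonneg hd.le hlam
    have habs : |softThresh g (γ * lam / (γ - 1)) / (η - 1 / (γ - 1))|
        = (|g| - γ * lam / (γ - 1)) / (η - 1 / (γ - 1)) := by
      rw [abs_div, abs_softThresh hx, abs_of_pos hd, max_eq_left (by linarith)]
    refine scad_quadratic_le_of_first_order hlam hγ₁ hc.le ?_ fun θ _ => ?_
    · rw [abs_div, abs_of_pos hd, ← mul_div_assoc, mul_softThresh hx, mul_div_assoc]
    · rw [habs, scadDeriv_of_mem_Icc ((le_div_iff₀ hd).mpr (by linarith))
        ((div_le_iff₀ hd).mpr (by linarith))]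
      have ht := mul_div_cancel₀ (|g| - γ * lam / (γ - 1)) hd.ne'
      refine (mul_eq_zero_of_left ?_ _).ge
      linarith
  · have habs : |g / η| = |g| / η := by rw [abs_div, abs_of_pos hη]
    refine scad_quadratic_le_of_first_order hlam hγ₁ hc.le ?_ fun θ _ => ?_
    · rw [habs, ← mul_div_assoc, ← mul_div_assoc, abs_mul_abs_self]
    · rw [habs, scadDeriv_of_ge hlam hγ₁ ((le_div_iff₀ hη).mpr (by linarith)),
        mul_div_cancel₀ _ hη.ne']
      simp
end

section
/- For every λ ≥ 0, γ > 1 and θ̃ ∈ ℝ, the univariate MC+-penalized least-squares function Q(θ) = (1/2)(θ − θ̃)² + p_λ(|θ|), where p_λ is the MC+ penalty with parameters λ and γ, is a convex function on ℝ. -/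
/-- The MC+ penalty with parameters `λ` and `γ`. -/
noncomputable def mcp (lam γ θ : ℝ) : ℝ :=
  if θ ≤ γ * lam then lam * θ - θ ^ 2 / (2 * γ) else γ * lam ^ 2 / 2

/-- The MC+ penalty is a concave quadratic plus the square of a hinge function. -/
lemma mcp_eq_quadratic_add_hinge_sq (lam θ : ℝ) {γ : ℝ} (hγ : γ ≠ 0) :
    mcp lam γ θ = lam * θ - θ ^ 2 / (2 * γ) + (2 * γ)⁻¹ * max (θ - γ * lam) 0 ^ 2 := by
  unfold mcp
  split_ifs with h
  · rw [max_eq_right (by linarith)]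
    ring
  · rw [max_eq_left (by linarith)]
    field_simp
    ring

/-- For every `λ ≥ 0`, `γ > 1` and `θ̃ ∈ ℝ`, the univariate
MC+-penalized least-squares function `Q(θ) = (1/2)(θ − θ̃)² + p_λ(|θ|)` is convex on `ℝ`. -/
theorem mcp_penalized_ls_convex (lam γ θt : ℝ) (hlam : 0 ≤ lam) (hγ : 1 < γ) :
    ConvexOn ℝ Set.univ (fun θ : ℝ => (1 / 2) * (θ - θt) ^ 2 + mcp lam γ |θ|) := by
  have hγ_pos : 0 < γ := by linarith
  have h_abs : ConvexOn ℝ Set.univ (fun θ : ℝ => |θ|) := convexOn_univ_norm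
  have h_hinge : ConvexOn ℝ Set.univ (fun θ : ℝ => max (|θ| - γ * lam) 0 ^ 2) :=
    ((h_abs.sub (concaveOn_const (γ * lam) convex_univ)).sup (convexOn_const 0 convex_univ)).pow
      (fun _ _ => le_max_right _ _) 2
  have h_sq : ConvexOn ℝ Set.univ (fun θ : ℝ => θ ^ 2) := even_two.convexOn_pow
  have h_lin : ConvexOn ℝ Set.univ (fun θ : ℝ => -θt * θ) :=
    (LinearMap.mulLeft ℝ (-θt)).convexOn convex_univ
  have h_coef : 0 ≤ (1 - γ⁻¹) / 2 := by
    have := inv_le_one_of_one_le₀ hγ.le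
    linarith
  have h_sum := ((((h_sq.smul h_coef).add h_lin).add_const (θt ^ 2 / 2)).add
    (h_abs.smul hlam)).add (h_hinge.smul (inv_nonneg.2 (by positivity : 0 ≤ 2 * γ)))
  refine h_sum.congr fun θ _ => ?_
  simp only [Pi.add_apply, smul_eq_mul, mcp_eq_quadratic_add_hinge_sq _ _ hγ_pos.ne', sq_abs]
  ring
end
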